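/- Let d ≥ 1 and let j be an integer with 1 ≤ j ≤ d-2. Then β_{i,i+j}(K[sd(Δ_{d-1})]) ≠ 0 for every integer i with 2^{j+1} - 2 - j ≤ i ≤ 2^d - 2^{d-j} - 1 - j. -/

import Mathlib

open Finset BigOperators

noncomputable section
open scoped Classical

/-- A finite abstract simplicial complex on (a finite subset of) `ℕ`,
given as its finite set of faces. -/
abbrev SC := Finset (Finset ℕ)

/-- `Δ` is a simplicial complex: it is closed under taking subsets of faces. -/
def IsComplex {α : Type*} [DecidableEq α] (Δ : Finset (Finset α)) : Prop :=
  ∀ s ∈ Δ, ∀ t ⊆ s, t ∈ Δ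

/-- The vertex set (ground set) of a complex: the union of all of its faces. -/
def vertexSet {α : Type*} [DecidableEq α] (Δ : Finset (Finset α)) : Finset α :=
  Δ.sup id

/-- The number of vertices of a complex. -/
def nverts {α : Type*} [DecidableEq α] (Δ : Finset (Finset α)) : ℕ :=
  (vertexSet Δ).card

/-- The full `(d-1)`-simplex `Δ_{d-1}`: all subsets of a `d`-element vertex set. -/
def simplexC (d : ℕ) : SC := (Finset.range d).powerset

/-- The boundary complex of the simplex on `k` vertices (a `(k-2)`-sphere):
all proper subsets of a `k`-element vertex set. -/
def boundaryC (k : ℕ) : SC := ((Finset.range k).powerset).erase (Finset.range k)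

/-- Encoding of finite subsets of `ℕ` as natural numbers (injective). -/
def enc : Finset ℕ → ℕ := Encodable.encode

/-- `C` is a chain of sets under inclusion. -/
def IsChainF (C : Finset (Finset ℕ)) : Prop := ∀ s ∈ C, ∀ t ∈ C, s ⊆ t ∨ t ⊆ s

/-- The barycentric subdivision `sd(Δ)`: its vertices are (encodings of) the
nonempty faces of `Δ`, and its faces are the chains of nonempty faces of `Δ`. -/
def sd (Δ : SC) : SC :=
  ((Δ.erase ∅).powerset.filter IsChainF).image (fun C => C.image enc)

/-- The induced subcomplex `Δ_W` on a vertex subset `W`. -/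
def inducedSC {α : Type*} [DecidableEq α] (Δ : Finset (Finset α)) (W : Finset α) :
    Finset (Finset α) := Δ.filter (fun s => s ⊆ W)

/-- `fvec Δ k` is the number of faces of `Δ` of cardinality `k`
(i.e. of dimension `k-1`); so `f_{i}^Δ = fvec Δ (i+1)`. -/
def fvec (Δ : SC) (k : ℕ) : ℕ := (Δ.filter (fun s => s.card = k)).card

/-- A minimal non-face of a complex. -/
def IsMinNonFace {α : Type*} [DecidableEq α] (Δ : Finset (Finset α)) (N : Finset α) : Prop :=
  N ⊆ vertexSet Δ ∧ N ∉ Δ ∧ ∀ M ⊂ N, M ∈ Δ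

/-- `t_1(K[Δ])`: the largest cardinality of a minimal non-face of `Δ`, equivalently the
largest degree of a minimal generator of the Stanley-Reisner ideal `I_Δ`. -/
def t1 {α : Type*} [DecidableEq α] (Δ : Finset (Finset α)) : ℕ :=
  ((vertexSet Δ).powerset.filter (fun N => IsMinNonFace Δ N)).sup Finset.card

/-- A complex is flag if all its minimal non-faces have cardinality `2`. -/
def IsFlag {α : Type*} [DecidableEq α] (Δ : Finset (Finset α)) : Prop :=
  ∀ N : Finset α, IsMinNonFace Δ N → N.card = 2

/-- A complex is a full simplex if it consists of all subsets of its vertex set. -/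
def IsFullSimplex {α : Type*} [DecidableEq α] (Δ : Finset (Finset α)) : Prop :=
  Δ = (vertexSet Δ).powerset

/-- Abstract isomorphism of simplicial complexes (possibly on different ground sets):
there is a map of vertices, injective on the vertex set, carrying the faces of the first
complex exactly onto the faces of the second. -/
def ComplexIso {α β : Type*} [DecidableEq α] [DecidableEq β]
    (Δ : Finset (Finset α)) (Γ : Finset (Finset β)) : Prop :=
  ∃ φ : α → β, Set.InjOn φ ↑(vertexSet Δ) ∧ Γ = Δ.image (fun s => s.image φ)

variable (K : Type*) [Field K]

/-- The boundary of (the indicator chain of) a single face, with the usual signs coming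
from the ordering of the vertices. -/
def bdryFace (s : Finset ℕ) : Finset ℕ →₀ K :=
  ∑ v ∈ s, ((-1 : K) ^ ((s.filter (fun w => w < v)).card)) • Finsupp.single (s.erase v) (1 : K)

/-- The simplicial boundary operator on the (augmented/reduced) chain space. -/
def bdry : (Finset ℕ →₀ K) →ₗ[K] (Finset ℕ →₀ K) :=
  Finsupp.lsum K fun s => LinearMap.toSpanSingleton K (Finset ℕ →₀ K) (bdryFace K s)

/-- The span of the faces of `Δ` of cardinality `n` (empty for `n < 0`):
the space of `(n-1)`-dimensional reduced chains of `Δ`. -/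
def facesSpan (Δ : SC) (n : ℤ) : Submodule K (Finset ℕ →₀ K) :=
  Submodule.span K ((fun s => Finsupp.single s (1 : K)) '' {s | s ∈ Δ ∧ (s.card : ℤ) = n})

/-- Reduced `(n-1)`-cycles of `Δ`. -/
def cyclesOn (Δ : SC) (n : ℤ) : Submodule K (Finset ℕ →₀ K) :=
  facesSpan K Δ n ⊓ LinearMap.ker (bdry K)

/-- Reduced `(n-1)`-boundaries of `Δ`. -/
def boundariesOn (Δ : SC) (n : ℤ) : Submodule K (Finset ℕ →₀ K) :=
  Submodule.map (bdry K) (facesSpan K Δ (n + 1))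

/-- `redHdim K Δ n = dim_K H̃_{n-1}(Δ; K)`, the dimension of reduced simplicial homology
of `Δ` in the degree whose chains are the faces of cardinality `n`. -/
def redHdim (Δ : SC) (n : ℤ) : ℕ :=
  Module.finrank K ↥(cyclesOn K Δ n) -
    Module.finrank K ↥(boundariesOn K Δ n ⊓ cyclesOn K Δ n)

/-- The graded Betti number `β_{i,j}(K[Δ]) = dim_K Tor_i^S(K[Δ], K)_j` of the
Stanley-Reisner ring of `Δ`, expressed (via Hochster's formula) through reduced homology of
induced subcomplexes: `β_{i,j} = Σ_{W ⊆ Ω, #W = j} dim_K H̃_{j-i-1}(Δ_W; K)`. -/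
def bettiSR (Δ : SC) (i j : ℕ) : ℕ :=
  ∑ W ∈ (vertexSet Δ).powerset.filter (fun W => W.card = j),
    redHdim K (inducedSC Δ W) ((j : ℤ) - i)

/-- The projective dimension of `K[Δ]` over the polynomial ring: the largest homological
degree with a nonzero Betti number. -/
def pdimSR (Δ : SC) : ℕ :=
  ((Finset.range (nverts Δ + 1)).filter
    (fun i => ∃ j ∈ Finset.range (2 * nverts Δ + 1), bettiSR K Δ i j ≠ 0)).sup id

/-- The depth of `K[Δ]` (via the Auslander–Buchsbaum formula). -/
def depthSR (Δ : SC) : ℕ := nverts Δ - pdimSR K Δ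

/-- The Castelnuovo–Mumford regularity of `K[Δ]`:
the largest `j - i` with `β_{i,j}(K[Δ]) ≠ 0`. -/
def regSR (Δ : SC) : ℕ :=
  ((Finset.range (nverts Δ + 1) ×ˢ Finset.range (2 * nverts Δ + 1))).sup
    (fun p => if bettiSR K Δ p.1 p.2 ≠ 0 then p.2 - p.1 else 0)

/-- The number of homological degrees `i` with `β_{i,i+j}(K[Δ]) ≠ 0`. -/
def strandCount (Δ : SC) (j : ℕ) : ℕ :=
  ((Finset.range (nverts Δ + 1)).filter (fun i => bettiSR K Δ i (i + j) ≠ 0)).card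

/-- The numbers `m_j(d)`: `m_j(d) = j` if `j ≤ d/2`, and
`m_j(d) = 2^{a+2}(c+d-j) - 2d + j` if `j ≥ d/2`, where `2j-d = a(d-j)+c`, `0 ≤ c < d-j`. -/
def mj (d j : ℕ) : ℕ :=
  if 2 * j ≤ d then j
  else 2 ^ ((2 * j - d) / (d - j) + 2) * ((2 * j - d) % (d - j) + (d - j)) + j - 2 * d

/-- `N(d)`: the number of vertices of `sd^3(Δ_{d-1})` not lying on the boundary
of `sd^3(Δ_{d-1})`. -/
def Nd (d : ℕ) : ℕ :=
  ((vertexSet (sd^[3] (simplexC d))) \ (vertexSet (sd^[3] (boundaryC d)))).card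

/-- The induced subcomplex `σ̃` of `Δ` spanned by the support of a chain `σ`:
all faces of `Δ` contained in some face of the support of `σ`. -/
def cycleCplx (Δ : SC) (σ : Finset ℕ →₀ K) : SC :=
  Δ.filter (fun F => ∃ G ∈ σ.support, F ⊆ G)

/-- `σ` is a minimal homology `(d-1)`-cycle of the `(d-1)`-dimensional complex `Δ`:
a nonzero `(d-1)`-cycle such that no nonzero `(d-1)`-cycle `σ'` satisfies
`f_i^{σ̃} > f_i^{σ̃'}` and `f_j^{σ̃} = f_j^{σ̃'}` for all `i < j ≤ d-1`, for some `i`. -/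
def IsMinimalCycle (Δ : SC) (d : ℕ) (σ : Finset ℕ →₀ K) : Prop :=
  σ ≠ 0 ∧ σ ∈ cyclesOn K Δ (d : ℤ) ∧
    ∀ σ' : Finset ℕ →₀ K, σ' ≠ 0 → σ' ∈ cyclesOn K Δ (d : ℤ) →
      ¬ ∃ i ≤ d - 1, fvec (cycleCplx K Δ σ') (i + 1) < fvec (cycleCplx K Δ σ) (i + 1) ∧
          ∀ j, i < j → j ≤ d - 1 →
            fvec (cycleCplx K Δ σ) (j + 1) = fvec (cycleCplx K Δ σ') (j + 1)

/-- The support of a lattice point, as a set of natural numbers. -/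
def tupSupp {n : ℕ} (a : Fin n → ℕ) : Finset ℕ :=
  (Finset.univ.filter (fun l : Fin n => a l ≠ 0)).image Fin.val

/-- The `k`-th component of `𝔦(a) = Σ_l a_l u_l`, where `u_l = e_l + ⋯ + e_n`;
so `𝔦(a)_k = Σ_{l ≤ k} a_l`. -/
def iComp {n : ℕ} (a : Fin n → ℤ) (k : Fin n) : ℤ :=
  ∑ l ∈ Finset.univ.filter (fun l : Fin n => l ≤ k), a l

/-- The compatibility condition on pairs of vertices in the edgewise subdivision:
`𝔦(a-b) ∈ {0,1}^n` or `𝔦(b-a) ∈ {0,1}^n`. -/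
def edgeOK {n : ℕ} (a b : Fin n → ℕ) : Prop :=
  (∀ k, iComp (fun l => (a l : ℤ) - (b l : ℤ)) k ∈ ({0, 1} : Set ℤ)) ∨
  (∀ k, iComp (fun l => (b l : ℤ) - (a l : ℤ)) k ∈ ({0, 1} : Set ℤ))

/-- The `r`-th edgewise subdivision of a complex `Δ` on vertex set `[n]`, as a complex on
the ground set `Ω_{r,n}` of lattice points (tuples). -/
def edgewiseT (n r : ℕ) (Δ : SC) : Finset (Finset (Fin n → ℕ)) :=
  (Finset.Nat.antidiagonalTuple n r).powerset.filter
    (fun F => F.sup tupSupp ∈ Δ ∧ ∀ a ∈ F, ∀ b ∈ F, edgeOK a b)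

/-- Encoding of lattice points as natural numbers (injective). -/
def encTup {n : ℕ} (a : Fin n → ℕ) : ℕ := Encodable.encode (List.ofFn a)

/-- The `r`-th edgewise subdivision `Δ^{⟨r⟩}`, re-encoded as a complex on `ℕ`. -/
def edgewise (n r : ℕ) (Δ : SC) : SC :=
  (edgewiseT n r Δ).image (fun F => F.image encTup)

end


section helpers

/-- rank-vs-label inversion sign -/
def eps6 (K : Type*) [Field K] (ρ : ℕ → ℕ) (s : Finset ℕ) : K :=
  ∏ a ∈ s, ∏ b ∈ s, (if a < b ∧ ρ b < ρ a then (-1 : K) else 1)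

lemma eps6_ne (K : Type*) [Field K] (ρ : ℕ → ℕ) (s : Finset ℕ) : eps6 K ρ s ≠ 0 := by
  unfold eps6
  refine Finset.prod_ne_zero_iff.2 fun a _ => Finset.prod_ne_zero_iff.2 fun b _ => ?_
  split_ifs <;> simp

lemma eps6_insert (K : Type*) [Field K] (ρ : ℕ → ℕ) (s : Finset ℕ) (v : ℕ) (hv : v ∉ s)
    (hρ : ∀ w ∈ s, ρ w ≠ ρ v) :
    eps6 K ρ (insert v s) * (-1) ^ ((s.filter (fun w => w < v)).card) =
      eps6 K ρ s * (-1) ^ ((s.filter (fun w => ρ w < ρ v)).card) := by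
  have hp : ∀ (p : ℕ → Prop) [DecidablePred p],
      (-1 : K) ^ ((s.filter p).card) = ∏ w ∈ s, (if p w then (-1 : K) else 1) := by
    intro p _
    rw [← Finset.prod_filter, Finset.prod_const]
  have h1 : eps6 K ρ (insert v s) = eps6 K ρ s *
      ((∏ w ∈ s, (if v < w ∧ ρ w < ρ v then (-1 : K) else 1)) *
       (∏ w ∈ s, (if w < v ∧ ρ v < ρ w then (-1 : K) else 1))) := by
    unfold eps6
    rw [Finset.prod_insert hv, Finset.prod_insert hv]
    have : ∀ a ∈ s, (∏ b ∈ insert v s, (if a < b ∧ ρ b < ρ a then (-1 : K) else 1)) =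
        (if a < v ∧ ρ v < ρ a then (-1 : K) else 1) *
          ∏ b ∈ s, (if a < b ∧ ρ b < ρ a then (-1 : K) else 1) :=
      fun a _ => Finset.prod_insert hv
    rw [Finset.prod_congr rfl this, Finset.prod_mul_distrib]
    simp only [lt_irrefl, false_and, if_false]
    ring
  rw [h1, hp, hp, mul_assoc, ← Finset.prod_mul_distrib, ← Finset.prod_mul_distrib]
  congr 1
  refine Finset.prod_congr rfl fun w hw => ?_
  have h2 := hρ w hw
  have h3 : w ≠ v := fun h => hv (h ▸ hw)
  rcases lt_or_gt_of_ne h2 with a | a <;> rcases lt_or_gt_of_ne h3 with b | b <;>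
    simp [a, b, a.not_gt, b.not_gt]

/-- initial sets of a permutation -/
def pre6 {n : ℕ} (π : Equiv.Perm (Fin n)) (k : ℕ) : Finset (Fin n) :=
  (Finset.univ.filter (fun i : Fin n => i.val ≤ k)).map π.toEmbedding

lemma mem_pre6 {n : ℕ} (π : Equiv.Perm (Fin n)) (k : ℕ) (x : Fin n) :
    π x ∈ pre6 π k ↔ x.val ≤ k := by
  simp [pre6]

lemma card_pre6 {n : ℕ} (π : Equiv.Perm (Fin n)) (k : ℕ) (hk : k < n) :
    (pre6 π k).card = k + 1 := by
  rw [pre6, Finset.card_map]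
  have : (Finset.univ.filter (fun i : Fin n => i.val ≤ k)) = Finset.Iic (⟨k, hk⟩ : Fin n) := by
    ext i; simp [Fin.le_def]
  rw [this, Fin.card_Iic]

lemma pre6_mono {n : ℕ} (π : Equiv.Perm (Fin n)) {k l : ℕ} (h : k ≤ l) :
    pre6 π k ⊆ pre6 π l := by
  intro x hx
  obtain ⟨y, rfl⟩ := π.surjective x
  rw [mem_pre6] at *
  omega

lemma pre6_swap {n : ℕ} (π : Equiv.Perm (Fin n)) (a b : Fin n) (hab : b.val = a.val + 1)
    (l : ℕ) (hl : l ≠ a.val) : pre6 (π * Equiv.swap a b) l = pre6 π l := by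
  ext x
  obtain ⟨y, rfl⟩ := (π * Equiv.swap a b).surjective x
  rw [mem_pre6, Equiv.Perm.mul_apply, mem_pre6]
  rw [Equiv.swap_apply_def]
  split_ifs with h1 h2
  · subst h1; omega
  · subst h2; omega
  · rfl

lemma pre6_inj {n : ℕ} (π σ : Equiv.Perm (Fin n))
    (h : ∀ k, k + 1 < n → pre6 π k = pre6 σ k) : π = σ := by
  have h' : ∀ k, pre6 π k = pre6 σ k := by
    intro k
    by_cases hk : k + 1 < n
    · exact h k hk
    · ext x
      obtain ⟨y, hy⟩ := π.surjective x
      obtain ⟨z, hz⟩ := σ.surjective x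
      have e1 : x ∈ pre6 π k := by rw [← hy, mem_pre6]; omega
      have e2 : x ∈ pre6 σ k := by rw [← hz, mem_pre6]; omega
      tauto
  ext x
  congr 1
  obtain ⟨y, hy⟩ := σ.surjective (π x)
  have key : ∀ k, x.val ≤ k ↔ y.val ≤ k := by
    intro k
    rw [← mem_pre6 π, ← mem_pre6 σ, hy, h' k]
  have : x = y := Fin.ext (le_antisymm ((key _).2 le_rfl) ((key _).1 le_rfl))
  rw [← hy, this]

/-- flag of a permutation -/
def flag6 {j : ℕ} (V : Finset (Fin (j+1)) → ℕ) (π : Equiv.Perm (Fin (j+1))) : Finset ℕ :=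
  (Finset.range j).image (fun k => V (pre6 π k))

lemma flag6_injOn {j : ℕ} (V : Finset (Fin (j+1)) → ℕ) (hV : Function.Injective V)
    (π : Equiv.Perm (Fin (j+1))) :
    Set.InjOn (fun k => V (pre6 π k)) (Finset.range j : Finset ℕ) := by
  intro a ha b hb h
  have := congrArg Finset.card (hV h)
  simp only [Finset.coe_range, Set.mem_Iio] at ha hb
  rw [card_pre6 _ _ (by omega), card_pre6 _ _ (by omega)] at this
  omega

lemma flag6_card {j : ℕ} (V : Finset (Fin (j+1)) → ℕ) (hV : Function.Injective V)
    (π : Equiv.Perm (Fin (j+1))) : (flag6 V π).card = j := by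
  rw [flag6, Finset.card_image_of_injOn (flag6_injOn V hV π), Finset.card_range]

lemma flag6_inj {j : ℕ} (V : Finset (Fin (j+1)) → ℕ) (hV : Function.Injective V)
    (π σ : Equiv.Perm (Fin (j+1))) (h : flag6 V π = flag6 V σ) : π = σ := by
  apply pre6_inj
  intro k hk
  have : V (pre6 π k) ∈ flag6 V σ := by
    rw [← h]
    exact Finset.mem_image_of_mem (fun k => V (pre6 π k)) (Finset.mem_range.2 (by omega))
  obtain ⟨l, hl, e⟩ := Finset.mem_image.1 this
  have e := hV e
  have hc := congrArg Finset.card e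
  rw [Finset.mem_range] at hl
  rw [card_pre6 _ _ (by omega), card_pre6 _ _ (by omega)] at hc
  have : l = k := by omega
  rw [← e, this]

/-- the fundamental cycle -/
noncomputable def cyc6 (K : Type*) [Field K] {j : ℕ} (ρ : ℕ → ℕ) (V : Finset (Fin (j+1)) → ℕ) :
    Finset ℕ →₀ K :=
  ∑ π : Equiv.Perm (Fin (j+1)),
    Finsupp.single (flag6 V π) (((Equiv.Perm.sign π : ℤ) : K) * eps6 K ρ (flag6 V π))

lemma bdry_single6 (K : Type*) [Field K] (s : Finset ℕ) (c : K) :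
    bdry K (Finsupp.single s c) = c • bdryFace K s := by
  simp [bdry]

lemma bdry_flag6 (K : Type*) [Field K] {j : ℕ} (ρ : ℕ → ℕ) (V : Finset (Fin (j+1)) → ℕ)
    (hV : Function.Injective V) (hρ : ∀ S, ρ (V S) = S.card) (π : Equiv.Perm (Fin (j+1))) :
    eps6 K ρ (flag6 V π) • bdryFace K (flag6 V π) =
      ∑ k ∈ Finset.range j, Finsupp.single (((Finset.range j).erase k).image
          (fun l => V (pre6 π l)))
        (eps6 K ρ (((Finset.range j).erase k).image (fun l => V (pre6 π l))) * (-1) ^ k) := by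
  have hinj := flag6_injOn V hV π
  rw [bdryFace, Finset.smul_sum]
  conv_lhs => rw [flag6]
  rw [Finset.sum_image hinj]
  refine Finset.sum_congr rfl fun k hk => ?_
  set s := ((Finset.range j).erase k).image (fun l => V (pre6 π l)) with hs
  set v := V (pre6 π k) with hv
  have hkj := Finset.mem_range.1 hk
  have hrank : ∀ l, l < j → ρ (V (pre6 π l)) = l + 1 := by
    intro l hl
    rw [hρ, card_pre6 _ _ (by omega)]
  have hvs : v ∉ s := by
    intro h
    obtain ⟨l, hl, e⟩ := Finset.mem_image.1 h
    rw [Finset.mem_erase] at hl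
    exact hl.1 (hinj (by simpa using hl.2) (by simpa using hk) e)
  have hins : (Finset.range j).image (fun l => V (pre6 π l)) = insert v s := by
    rw [hs, hv, ← Finset.image_insert (fun l => V (pre6 π l)), Finset.insert_erase hk]
  rw [hins, Finset.erase_insert hvs]
  have hf : (insert v s).filter (fun w => w < v) = s.filter (fun w => w < v) := by
    rw [Finset.filter_insert]; simp
  rw [hf, smul_smul, eps6_insert K ρ s v hvs, Finsupp.smul_single, smul_eq_mul, mul_one]
  · congr 3
    have : s.filter (fun w => ρ w < ρ v) = (Finset.range k).image (fun l => V (pre6 π l)) := by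
      ext x
      simp only [hs, Finset.mem_filter, Finset.mem_image, Finset.mem_erase, Finset.mem_range]
      constructor
      · rintro ⟨⟨l, ⟨h1, h2⟩, rfl⟩, h3⟩
        rw [hv, hrank l h2, hrank k hkj] at h3
        exact ⟨l, by omega, rfl⟩
      · rintro ⟨l, h1, rfl⟩
        refine ⟨⟨l, ⟨by omega, by omega⟩, rfl⟩, ?_⟩
        rw [hv, hrank l (by omega), hrank k hkj]
        omega
    rw [this, Finset.card_image_of_injOn, Finset.card_range]
    refine hinj.mono ?_
    intro x hx
    simp at hx ⊢
    omega
  · intro w hw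
    obtain ⟨l, hl, rfl⟩ := Finset.mem_image.1 hw
    rw [Finset.mem_erase, Finset.mem_range] at hl
    rw [hv, hrank l hl.2, hrank k hkj]
    omega

lemma bdry_cyc6 (K : Type*) [Field K] {j : ℕ} (ρ : ℕ → ℕ) (V : Finset (Fin (j+1)) → ℕ)
    (hV : Function.Injective V) (hρ : ∀ S, ρ (V S) = S.card) :
    bdry K (cyc6 K ρ V) = 0 := by
  rw [cyc6, map_sum]
  simp only [bdry_single6, mul_smul]
  simp only [bdry_flag6 K ρ V hV hρ, Finset.smul_sum]
  rw [Finset.sum_comm]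
  refine Finset.sum_eq_zero fun k hk => ?_
  have hkj := Finset.mem_range.1 hk
  let a : Fin (j+1) := ⟨k, by omega⟩
  let b : Fin (j+1) := ⟨k+1, by omega⟩
  have hab : a ≠ b := by simp [a, b]
  refine Finset.sum_involution (fun π _ => π * Equiv.swap a b) ?_ ?_ ?_ ?_
  · intro π _
    have : ((Finset.range j).erase k).image (fun l => V (pre6 (π * Equiv.swap a b) l)) =
        ((Finset.range j).erase k).image (fun l => V (pre6 π l)) := by
      refine Finset.image_congr ?_
      intro l hl
      have hl : l ≠ k := by simp at hl; tauto
      simp only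
      rw [pre6_swap π a b rfl l hl]
    rw [this, Equiv.Perm.sign_mul, Equiv.Perm.sign_swap hab]
    simp
  · intro π _ _ h
    have := mul_eq_left.1 h
    exact hab (Equiv.swap_eq_one_iff.1 this)
  · intros; exact Finset.mem_univ _
  · intro π _
    simp [mul_assoc]

lemma cyc6_apply (K : Type*) [Field K] {j : ℕ} (ρ : ℕ → ℕ) (V : Finset (Fin (j+1)) → ℕ)
    (hV : Function.Injective V) : cyc6 K ρ V (flag6 V 1) ≠ 0 := by
  rw [cyc6, Finsupp.finsetSum_apply, Finset.sum_eq_single 1]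
  · simp [eps6_ne]
  · intro π _ h
    rw [Finsupp.single_apply, if_neg]
    exact fun e => h (flag6_inj V hV _ _ e)
  · simp

lemma redHdim6 (K : Type*) [Field K] (Δ : SC) (n : ℕ) (z : Finset ℕ →₀ K)
    (σ : Finset ℕ) (hz : z ∈ facesSpan K Δ n) (hb : bdry K z = 0) (hσ : z σ ≠ 0)
    (hfac : ∀ τ ∈ Δ, τ.card = n + 1 → ¬ σ ⊆ τ) : redHdim K Δ n ≠ 0 := by
  have hfin : FiniteDimensional K (facesSpan K Δ n) := by
    apply FiniteDimensional.span_of_finite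
    apply Set.Finite.image
    exact (Δ.finite_toSet).subset fun s hs => hs.1
  have hfin2 : FiniteDimensional K (cyclesOn K Δ n) :=
    Submodule.finiteDimensional_of_le (inf_le_left : cyclesOn K Δ n ≤ facesSpan K Δ n)
  have hlt : boundariesOn K Δ n ⊓ cyclesOn K Δ n < cyclesOn K Δ n := by
    refine lt_of_le_of_ne inf_le_right fun h => ?_
    have hzc : z ∈ cyclesOn K Δ n := ⟨hz, hb⟩
    rw [← h] at hzc
    have hzb := hzc.1
    rw [boundariesOn, facesSpan, Submodule.map_span] at hzb
    apply hσ
    clear hσ hb hz h hzc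
    induction hzb using Submodule.span_induction with
    | mem x hx =>
      obtain ⟨_, ⟨τ, ⟨h1, h2⟩, rfl⟩, rfl⟩ := hx
      have h2 : τ.card = n + 1 := by exact_mod_cast h2
      simp only [bdry_single6, one_smul, bdryFace, Finsupp.finsetSum_apply]
      refine Finset.sum_eq_zero fun v _ => ?_
      rw [Finsupp.smul_apply, Finsupp.single_apply, if_neg, smul_zero]
      rintro rfl
      exact hfac τ h1 h2 (Finset.erase_subset _ _)
    | zero => rfl
    | add x y _ _ hx hy => simp [hx, hy]
    | smul c x _ hx => simp [hx]
  have := Submodule.finrank_lt_finrank_of_lt hlt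
  unfold redHdim
  omega

/-- block map -/
def blk6 (m : ℕ) (i : ℕ) : Finset ℕ := if i = 0 then Finset.range m else {m - 1 + i}

def U6 (m j : ℕ) (S : Finset (Fin (j+1))) : Finset ℕ := S.biUnion (fun i => blk6 m i.val)

lemma mem_U6 (m j : ℕ) (hm : 1 ≤ m) (S : Finset (Fin (j+1))) (x : ℕ) :
    x ∈ U6 m j S ↔ ∃ i ∈ S, x + 1 - m = i.val := by
  simp only [U6, Finset.mem_biUnion, blk6]
  refine exists_congr fun i => and_congr_right fun _ => ?_
  split_ifs with h
  · simp; omega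
  · simp; omega

lemma U6_sub_iff (m j : ℕ) (hm : 1 ≤ m) (S T : Finset (Fin (j+1))) :
    U6 m j S ⊆ U6 m j T ↔ S ⊆ T := by
  constructor
  · intro h i hi
    have : m - 1 + i.val ∈ U6 m j S := (mem_U6 m j hm S _).2 ⟨i, hi, by omega⟩
    obtain ⟨i', h1, h2⟩ := (mem_U6 m j hm T _).1 (h this)
    have : i = i' := Fin.ext (by omega)
    rwa [this]
  · intro h x hx
    rw [mem_U6 _ _ hm] at *
    obtain ⟨i, hi, e⟩ := hx
    exact ⟨i, h hi, e⟩

lemma U6_inj (m j : ℕ) (hm : 1 ≤ m) : Function.Injective (U6 m j) := by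
  intro S T h
  exact Finset.Subset.antisymm ((U6_sub_iff m j hm S T).1 h.subset)
    ((U6_sub_iff m j hm T S).1 h.symm.subset)

lemma U6_univ (m j : ℕ) (hm : 1 ≤ m) : U6 m j Finset.univ = Finset.range (m + j) := by
  ext x
  rw [mem_U6 _ _ hm, Finset.mem_range]
  constructor
  · rintro ⟨i, _, h⟩; omega
  · intro h; exact ⟨⟨x + 1 - m, by omega⟩, Finset.mem_univ _, rfl⟩

lemma U6_pre (m j : ℕ) (hm : 1 ≤ m) (k : ℕ) (hk : k ≤ j) :
    U6 m j (pre6 1 k) = Finset.range (m + k) := by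
  ext x
  rw [mem_U6 _ _ hm, Finset.mem_range]
  constructor
  · rintro ⟨i, hi, h⟩
    have := (mem_pre6 (1 : Equiv.Perm (Fin (j+1))) k i).1 hi
    omega
  · intro h
    exact ⟨⟨x + 1 - m, by omega⟩, (mem_pre6 (1 : Equiv.Perm (Fin (j+1))) k _).2
      (by simp only; omega), rfl⟩

lemma enc6_inj : Function.Injective enc := Encodable.encode_injective

lemma mem_sd6 (Δ : SC) (σ : Finset ℕ) : σ ∈ sd Δ ↔
    ∃ C : Finset (Finset ℕ), C ⊆ Δ.erase ∅ ∧ IsChainF C ∧ C.image enc = σ := by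
  simp only [sd, Finset.mem_image, Finset.mem_filter, Finset.mem_powerset, and_assoc]

/-- upper family -/
def big6 (d m : ℕ) : Finset (Finset ℕ) :=
  insert (Finset.range m)
    (((Finset.range d).powerset \ (Finset.range m).powerset).erase (Finset.range d))

lemma card_big6 (d m : ℕ) (h : m < d) : 2 ^ d - 2 ^ m - 1 ≤ (big6 d m).card := by
  unfold big6
  refine le_trans ?_ (Finset.card_le_card (Finset.subset_insert _ _))
  refine le_trans ?_ Finset.pred_card_le_card_erase
  rw [Finset.card_sdiff_of_subset (Finset.powerset_mono.2 (Finset.range_mono h.le))]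
  simp

lemma mem_big6 (d m : ℕ) (h : m < d) (B : Finset ℕ) : B ∈ big6 d m ↔
    B = Finset.range m ∨ (B ≠ Finset.range d ∧ B ⊆ Finset.range d ∧ ¬ B ⊆ Finset.range m) := by
  simp [big6]

/-- lower family -/
def small6 (m j : ℕ) : Finset (Finset ℕ) :=
  ((Finset.univ.erase ∅).erase Finset.univ).image (U6 m j)

lemma card_small6 (m j : ℕ) : (small6 m j).card ≤ 2 ^ (j + 1) - 2 := by
  refine Finset.card_image_le.trans ?_
  rw [Finset.card_erase_of_mem, Finset.card_erase_of_mem (Finset.mem_univ _)]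
  · simp; omega
  · simp [Finset.univ_eq_empty_iff]

lemma small6_sub (m j : ℕ) (hm : 1 ≤ m) (hj : 1 ≤ j) : small6 m j ⊆ big6 (m + j) m := by
  intro B hB
  obtain ⟨S, hS, rfl⟩ := Finset.mem_image.1 hB
  simp only [Finset.mem_erase, Finset.mem_univ, and_true] at hS
  rw [mem_big6 _ _ (by omega)]
  have h0 : U6 m j (pre6 1 0) = Finset.range m := U6_pre m j hm 0 (by omega)
  rw [← h0, ← U6_univ m j hm, U6_sub_iff _ _ hm, U6_sub_iff _ _ hm]
  by_cases h : S = pre6 1 0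
  · left; rw [h]
  · right
    refine ⟨fun e => hS.1 (U6_inj m j hm e), Finset.subset_univ _, fun hs => h ?_⟩
    apply Finset.eq_of_subset_of_card_le hs
    rw [card_pre6 _ _ (by omega)]
    exact Finset.card_pos.2 (Finset.nonempty_iff_ne_empty.2 hS.2)

lemma big6_sub (m j : ℕ) (hm : 1 ≤ m) (hj : 1 ≤ j) (B : Finset ℕ) (hB : B ∈ big6 (m+j) m) :
    B ∈ (simplexC (m + j)).erase ∅ := by
  rw [mem_big6 _ _ (by omega)] at hB
  rw [Finset.mem_erase, simplexC, Finset.mem_powerset]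
  rcases hB with rfl | ⟨h1, h2, h3⟩
  · refine ⟨?_, Finset.range_mono (by omega)⟩
    simp; omega
  · refine ⟨?_, h2⟩
    rintro rfl
    exact h3 (Finset.empty_subset _)

lemma main6 (K : Type*) [Field K] (m j : ℕ) (hm : 1 ≤ m) (hj : 1 ≤ j) (W : Finset ℕ)
    (hW0 : (small6 m j).image enc ⊆ W) (hW1 : W ⊆ (big6 (m+j) m).image enc) :
    redHdim K (inducedSC (sd (simplexC (m+j))) W) j ≠ 0 := by
  let V : Finset (Fin (j+1)) → ℕ := fun S => enc (U6 m j S)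
  have hV : Function.Injective V := enc6_inj.comp (U6_inj m j hm)
  let ρ : ℕ → ℕ := fun n => (Function.invFun V n).card
  have hρ : ∀ S, ρ (V S) = S.card := fun S => by
    simp only [ρ]; rw [Function.leftInverse_invFun hV S]
  have hsm : ∀ π : Equiv.Perm (Fin (j+1)), ∀ k < j, U6 m j (pre6 π k) ∈ small6 m j := by
    intro π k hk
    refine Finset.mem_image_of_mem _ ?_
    have := card_pre6 π k (by omega)
    simp only [Finset.mem_erase, Finset.mem_univ, and_true]
    constructor
    · intro e; rw [e] at this; simp at this; omega
    · intro e; rw [e] at this; simp at this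
  refine redHdim6 K _ j (cyc6 K ρ V) (flag6 V 1) ?_ (bdry_cyc6 K ρ V hV hρ)
    (cyc6_apply K ρ V hV) ?_
  · refine Submodule.sum_mem _ fun π _ => ?_
    rw [← mul_one (((Equiv.Perm.sign π : ℤ) : K) * eps6 K ρ (flag6 V π)), ← smul_eq_mul,
      ← Finsupp.smul_single]
    refine Submodule.smul_mem _ _ (Submodule.subset_span ⟨flag6 V π, ⟨?_, ?_⟩, rfl⟩)
    · rw [inducedSC, Finset.mem_filter, mem_sd6]
      refine ⟨⟨(Finset.range j).image (fun k => U6 m j (pre6 π k)), ?_, ?_, ?_⟩, ?_⟩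
      · intro B hB
        obtain ⟨k, hk, rfl⟩ := Finset.mem_image.1 hB
        exact big6_sub m j hm hj _ (small6_sub m j hm hj (hsm π k (Finset.mem_range.1 hk)))
      · intro A hA B hB
        obtain ⟨k, hk, rfl⟩ := Finset.mem_image.1 hA
        obtain ⟨l, hl, rfl⟩ := Finset.mem_image.1 hB
        rw [U6_sub_iff _ _ hm, U6_sub_iff _ _ hm]
        rcases le_total k l with h | h
        · exact Or.inl (pre6_mono π h)
        · exact Or.inr (pre6_mono π h)
      · rw [Finset.image_image]; rfl
      · intro x hx
        obtain ⟨k, hk, rfl⟩ := Finset.mem_image.1 hx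
        exact hW0 (Finset.mem_image_of_mem _ (hsm π k (Finset.mem_range.1 hk)))
    · rw [flag6_card V hV]
  · intro τ hτ hc hsub
    rw [inducedSC, Finset.mem_filter, mem_sd6] at hτ
    obtain ⟨⟨C, hC1, hC2, rfl⟩, hτW⟩ := hτ
    have hin : ∀ k < j, Finset.range (m + k) ∈ C := by
      intro k hk
      have : V (pre6 1 k) ∈ C.image enc :=
        hsub (Finset.mem_image_of_mem (fun k => V (pre6 1 k)) (Finset.mem_range.2 hk))
      obtain ⟨B, hB, e⟩ := Finset.mem_image.1 this
      have e := enc6_inj e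
      rw [U6_pre m j hm k hk.le] at e
      rwa [← e]
    have hall : C ⊆ (Finset.range j).image (fun k => Finset.range (m + k)) := by
      intro B hB
      have hB1 : B ∈ big6 (m+j) m := by
        obtain ⟨B', h1, h2⟩ := Finset.mem_image.1 (hW1 (hτW (Finset.mem_image_of_mem enc hB)))
        rwa [← enc6_inj h2]
      rw [mem_big6 _ _ (by omega)] at hB1
      rcases hB1 with rfl | ⟨h1, h2, h3⟩
      · exact Finset.mem_image.2 ⟨0, Finset.mem_range.2 (by omega), rfl⟩
      · have h4 : Finset.range m ⊆ B := by
          rcases hC2 B hB _ (hin 0 (by omega)) with h | h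
          · exact absurd h h3
          · exact h
        have c1 : m ≤ B.card := by simpa using Finset.card_le_card h4
        have c2 : B.card < m + j := by
          simpa using Finset.card_lt_card (Finset.ssubset_iff_subset_ne.2 ⟨h2, h1⟩)
        refine Finset.mem_image.2 ⟨B.card - m, Finset.mem_range.2 (by omega), ?_⟩
        have hcard : (Finset.range (m + (B.card - m))).card = B.card := by simp; omega
        rcases hC2 B hB _ (hin (B.card - m) (by omega)) with h | h
        · exact (Finset.eq_of_subset_of_card_le h hcard.le).symm
        · exact Finset.eq_of_subset_of_card_le h hcard.ge
    have := Finset.card_le_card hall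
    have h5 : ((Finset.range j).image (fun k => Finset.range (m + k))).card ≤ j :=
      Finset.card_image_le.trans (by simp)
    have h6 : (C.image enc).card ≤ C.card := Finset.card_image_le
    omega

end helpers

/-- For `1 ≤ j ≤ d-2` one has `β_{i,i+j}(K[sd(Δ_{d-1})]) ≠ 0` for all
`2^{j+1} - 2 - j ≤ i ≤ 2^d - 2^{d-j} - 1 - j`. -/
theorem statement_6 (K : Type*) [Field K] (d j : ℕ) (hd : 1 ≤ d) (hj1 : 1 ≤ j)
    (hj2 : j ≤ d - 2) (i : ℕ) (h1 : 2 ^ (j + 1) - 2 - j ≤ i)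
    (h2 : i ≤ 2 ^ d - 2 ^ (d - j) - 1 - j) :
    bettiSR K (sd (simplexC d)) i (i + j) ≠ 0 := by
  have hd3 : 3 ≤ d := by omega
  obtain ⟨m, rfl⟩ : ∃ m, d = m + j := ⟨d - j, by omega⟩
  have hm : 1 ≤ m := by omega
  rw [Nat.add_sub_cancel] at h2
  have hc0 : ((small6 m j).image enc).card ≤ i + j := by
    have := card_small6 m j
    have h := Finset.card_image_le (s := small6 m j) (f := enc)
    omega
  have hsub : (small6 m j).image enc ⊆ (big6 (m+j) m).image enc :=
    Finset.image_subset_image (small6_sub m j hm hj1)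
  have hpos : j ≤ 2 ^ (m + j) - 2 ^ m - 1 := by
    have e1 : 2 ^ (m + j) = 2 ^ m * 2 ^ j := pow_add 2 m j
    have e2 : j + 1 ≤ 2 ^ j := Nat.lt_two_pow_self
    have e3 : 2 ≤ 2 ^ m := by
      calc 2 = 2 ^ 1 := rfl
        _ ≤ 2 ^ m := Nat.pow_le_pow_right (by norm_num) hm
    have e4 : 2 ^ m * (j + 1) ≤ 2 ^ m * 2 ^ j := Nat.mul_le_mul_left _ e2
    have e5 : 2 * j ≤ 2 ^ m * j := Nat.mul_le_mul_right _ e3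
    have e6 : 2 ^ m * (j + 1) = 2 ^ m * j + 2 ^ m := by ring
    omega
  have hc1 : i + j ≤ ((big6 (m+j) m).image enc).card := by
    rw [Finset.card_image_of_injective _ enc6_inj]
    have := card_big6 (m + j) m (by omega)
    omega
  obtain ⟨W, hW0, hW1, hWc⟩ := Finset.exists_subsuperset_card_eq hsub hc0 hc1
  have hmain := main6 K m j hm hj1 W hW0 hW1
  have hWv : W ⊆ vertexSet (sd (simplexC (m + j))) := by
    intro x hx
    obtain ⟨B, hB, rfl⟩ := Finset.mem_image.1 (hW1 hx)
    rw [vertexSet, Finset.mem_sup]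
    refine ⟨{enc B}, (mem_sd6 _ _).2 ⟨{B}, ?_, ?_, by simp⟩, by simp⟩
    · simpa using big6_sub m j hm hj1 B hB
    · intro s hs t ht
      rw [Finset.mem_singleton] at hs ht
      rw [hs, ht]
      exact Or.inl (Finset.Subset.refl _)
  unfold bettiSR
  intro h
  rw [Finset.sum_eq_zero_iff] at h
  have := h W (Finset.mem_filter.2 ⟨Finset.mem_powerset.2 hWv, hWc⟩)
  apply hmain
  rw [← this]
  congr 1
  push_cast
  ring
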